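/- arXiv:2106.13157 — 5 statements merged into one kernel-verified Lean document; each statement's English description precedes it below -/
import Mathlib

section
/- For every integer k ≥ 1 and every 2 ≤ r ≤ k, the continuant polynomials of type β satisfy the recurrence β(r+1,k) = x_r·β(r,k) + y_{r−1}·β(r−1,k) in ℤ[x_1,…,x_k,y_1,…,y_k]. -/
noncomputable section

/-- The polynomial ring `ℤ[x_1,…,x_k,y_1,…,y_k]` with indices extended
periodically (`x_{i+k} = x_i`, `y_{i+k} = y_i`), realized by indexing the
two families of variables by `ZMod k`. -/
abbrev ContRing (k : ℕ) := MvPolynomial (ZMod k ⊕ ZMod k) ℤ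

/-- The variable `x_i` (indices taken modulo `k`). -/
def Xv (k : ℕ) (i : ℕ) : ContRing k := MvPolynomial.X (Sum.inl (i : ZMod k))

/-- The variable `y_i` (indices taken modulo `k`). -/
def Yv (k : ℕ) (i : ℕ) : ContRing k := MvPolynomial.X (Sum.inr (i : ZMod k))

/-- `C2 S m` is the collection of `m`-element subsets `{i_1<⋯<i_m}` of `S`
satisfying `i_{j+1} − i_j ≥ 2` for all `j`. -/
def C2 (S : Finset ℕ) (m : ℕ) : Finset (Finset ℕ) :=
  (Finset.powersetCard m S).filter fun I => ∀ i ∈ I, ∀ j ∈ I, i < j → i + 2 ≤ j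

/-- The monomial `p(I)`: obtained from `x_1 x_2 ⋯ x_r` by replacing, for each
`i ∈ I`, the adjacent pair `x_i x_{i+1}` by `y_i`. -/
def pMono (k r : ℕ) (I : Finset ℕ) : ContRing k :=
  (∏ i ∈ I, Yv k i) *
    ∏ j ∈ (Finset.Icc 1 r).filter (fun j => j ∉ I ∧ j - 1 ∉ I), Xv k j

/-- The monomial `q(I)`: obtained from `y_k · x_2 x_3 ⋯ x_{r−1}` by replacing,
for each `i ∈ I`, the adjacent pair `x_i x_{i+1}` by `y_i`. -/
def qMono (k r : ℕ) (I : Finset ℕ) : ContRing k :=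
  Yv k k * (∏ i ∈ I, Yv k i) *
    ∏ j ∈ (Finset.Icc 2 (r - 1)).filter (fun j => j ∉ I ∧ j - 1 ∉ I), Xv k j

/-- The continuant polynomial of type `α` (combinatorial definition):
`α(r,k) = Σ_{m=0}^{⌊r/2⌋} Σ_{I ∈ C₂({1,…,r−1},m)} p(I)`. -/
def alphaComb (k r : ℕ) : ContRing k :=
  ∑ m ∈ Finset.range (r / 2 + 1), ∑ I ∈ C2 (Finset.Icc 1 (r - 1)) m, pMono k r I

/-- The continuant polynomial of type `α`, extended to all `n` by the
recurrence `α(n,k) = x_n·α(n−1,k) + y_{n−1}·α(n−2,k)` for `n > k`. -/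
def alphaN (k : ℕ) (n : ℕ) : ContRing k :=
  if h : n ≤ k then alphaComb k n
  else Xv k n * alphaN k (n - 1) + Yv k (n - 1) * alphaN k (n - 2)
termination_by n
decreasing_by all_goals omega

/-- The continuant polynomial of type `α` with an integer argument,
so that `α(−1,k) = 0`. -/
def alphaZ (k : ℕ) (r : ℤ) : ContRing k :=
  if r < 0 then 0 else alphaN k r.toNat

/-- The continuant polynomial of type `β`:
`β(r,k) = Σ_{m=0}^{⌊(r−2)/2⌋} Σ_{I ∈ C₂({2,…,r−2},m)} q(I)`, with
`β(0,k) = β(1,k) = 0`. -/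
def betaP (k : ℕ) : ℕ → ContRing k
  | 0 => 0
  | 1 => 0
  | r + 2 => ∑ m ∈ Finset.range (r / 2 + 1), ∑ I ∈ C2 (Finset.Icc 2 r) m, qMono k (r + 2) I

/-- The continuant polynomial of type `π`: `π(r,k) = α(r,k) + β(r,k)`. -/
def piP (k r : ℕ) : ContRing k := alphaN k r + betaP k r

/-- The shift by `s`: the ring automorphism of `ℤ[x_1,…,x_k,y_1,…,y_k]`
sending `x_i ↦ x_{i+s}` and `y_i ↦ y_{i+s}` (indices modulo `k`). -/
def shiftP (k s : ℕ) : ContRing k →ₐ[ℤ] ContRing k :=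
  MvPolynomial.rename (Sum.map (· + (s : ZMod k)) (· + (s : ZMod k)))

/-- The generalized Fibonacci polynomial of order `m`, evaluated at `x, y`:
`U_m(x,y) = Σ_{i=0}^{⌊(m−1)/2⌋} (−1)^i · C(m−1−i, i) · x^{m−1−2i} · y^i`,
with `U_0 = 0`. -/
def genFib {K : Type*} [CommRing K] (x y : K) : ℕ → K
  | 0 => 0
  | m + 1 => ∑ i ∈ Finset.range (m / 2 + 1),
      (-1 : K) ^ i * (Nat.choose (m - i) i : K) * x ^ (m - 2 * i) * y ^ i

/-- The tridiagonal `k`-Toeplitz matrix `T^k_n(ā,b̄,c̄)`: the `n×n` matrix whose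
`(i,i)` entry is `a_i`, `(i,i+1)` entry is `b_i`, `(i+1,i)` entry is `c_i`
(1-based indices, extended periodically modulo `k`), and all other entries `0`. -/
def triToeplitz {K : Type*} [CommRing K] (k n : ℕ) (a b c : ZMod k → K) :
    Matrix (Fin n) (Fin n) K :=
  Matrix.of fun i j =>
    if (i : ℕ) = (j : ℕ) then a (((i : ℕ) + 1 : ℕ) : ZMod k)
    else if (j : ℕ) = (i : ℕ) + 1 then b (((i : ℕ) + 1 : ℕ) : ZMod k)
    else if (i : ℕ) = (j : ℕ) + 1 then c (((j : ℕ) + 1 : ℕ) : ZMod k)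
    else 0

/-- The universal determinant `D^{ā,d̄}(n,k)`: the determinant of the `n×n`
tridiagonal matrix with main diagonal generated periodically by `ā`, all
upper-diagonal entries `1`, and lower diagonal generated periodically by `d̄`. -/
def univDet {K : Type*} [CommRing K] (k : ℕ) (a d : ZMod k → K) (n : ℕ) : K :=
  (triToeplitz k n a (fun _ => 1) d).det

/-- The universal determinant with an integer size argument, so that
`D^{ā,d̄}(−1,k) = 0` (and `D^{ā,d̄}(0,k) = 1`). -/
def univDetZ {K : Type*} [CommRing K] (k : ℕ) (a d : ZMod k → K) (n : ℤ) : K :=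
  if n < 0 then 0 else univDet k a d n.toNat

/-- The cyclic shift `σ_s` of a periodic vector by `s` places to the left:
`(σ_s a)_i = a_{i+s}`. -/
def shiftVec {K : Type*} {k : ℕ} (s : ℕ) (a : ZMod k → K) : ZMod k → K :=
  fun i => a (i + (s : ZMod k))


/-- A finite set of naturals is sparse if distinct elements differ by at least `2`. -/
def IsSparse (I : Finset ℕ) : Prop := ∀ i ∈ I, ∀ j ∈ I, i < j → i + 2 ≤ j

instance : DecidablePred IsSparse := fun I =>
  inferInstanceAs (Decidable (∀ i ∈ I, ∀ j ∈ I, i < j → i + 2 ≤ j))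

lemma IsSparse.card_le {I : Finset ℕ} {r : ℕ} (hI : I ⊆ Finset.Icc 2 r) (h : IsSparse I) :
    I.card ≤ r / 2 := by
  have hcard : I.card ≤ (Finset.Icc 1 (r / 2)).card := by
    refine Finset.card_le_card_of_injOn (fun i => i / 2) (fun i hi => ?_) (fun i hi j hj hij => ?_)
    · have := Finset.mem_Icc.1 (hI hi)
      simp only [Finset.coe_Icc, Set.mem_Icc]
      omega
    · have h₁ := h i hi j hj
      have h₂ := h j hj i hi
      dsimp only at hij
      omega
  simpa using hcard

/-- The cardinality grading in the definition of `betaP` omits no sparse set. -/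
lemma betaP_eq_sum_sparse (k r : ℕ) :
    betaP k (r + 2) = ∑ I ∈ (Finset.Icc 2 r).powerset with IsSparse I, qMono k (r + 2) I := by
  have hmaps : ∀ I ∈ (Finset.Icc 2 r).powerset.filter IsSparse,
      I.card ∈ Finset.range (r / 2 + 1) := fun I hI => by
    rw [Finset.mem_filter, Finset.mem_powerset] at hI
    exact Finset.mem_range.2 (Nat.lt_succ_of_le (hI.2.card_le hI.1))
  rw [betaP, ← Finset.sum_fiberwise_of_maps_to hmaps]
  refine Finset.sum_congr rfl fun m _ => Finset.sum_congr ?_ fun _ _ => rfl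
  ext I
  simp only [C2, IsSparse, Finset.mem_filter, Finset.mem_powersetCard, Finset.mem_powerset]
  tauto

lemma qMono_succ {r : ℕ} (k : ℕ) {I : Finset ℕ} (hI : I ⊆ Finset.Icc 2 r) :
    qMono k (r + 3) I = Xv k (r + 2) * qMono k (r + 2) I := by
  have hmem : ∀ j ∈ I, j ≤ r := fun j hj => (Finset.mem_Icc.1 (hI hj)).2
  have hfilter : (Finset.Icc 2 (r + 3 - 1)).filter (fun j => j ∉ I ∧ j - 1 ∉ I) =
      insert (r + 2) ((Finset.Icc 2 (r + 2 - 1)).filter (fun j => j ∉ I ∧ j - 1 ∉ I)) := by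
    ext j
    simp only [Finset.mem_filter, Finset.mem_insert, Finset.mem_Icc]
    grind
  rw [qMono, qMono, hfilter, Finset.prod_insert (by simp)]
  ring

lemma qMono_insert {r : ℕ} (k : ℕ) {I : Finset ℕ} (hI : I ⊆ Finset.Icc 2 r) :
    qMono k (r + 4) (insert (r + 2) I) = Yv k (r + 2) * qMono k (r + 2) I := by
  have hmem : ∀ j ∈ I, j ≤ r := fun j hj => (Finset.mem_Icc.1 (hI hj)).2
  have hfilter : (Finset.Icc 2 (r + 4 - 1)).filter
        (fun j => j ∉ insert (r + 2) I ∧ j - 1 ∉ insert (r + 2) I) =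
      (Finset.Icc 2 (r + 2 - 1)).filter (fun j => j ∉ I ∧ j - 1 ∉ I) := by
    ext j
    simp only [Finset.mem_filter, Finset.mem_insert, Finset.mem_Icc]
    grind
  rw [qMono, qMono, hfilter, Finset.prod_insert (fun h => by have := hmem _ h; omega)]
  ring

lemma filter_isSparse_insert (r : ℕ) :
    (Finset.Icc 2 (r + 1)).powerset.filter (fun I => IsSparse (insert (r + 2) I)) =
      (Finset.Icc 2 r).powerset.filter IsSparse := by
  ext I
  rw [Finset.mem_filter, Finset.mem_filter]
  simp only [Finset.mem_powerset, Finset.subset_iff, Finset.mem_Icc]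
  unfold IsSparse
  simp only [Finset.mem_insert]
  constructor
  · rintro ⟨hI, h⟩
    refine ⟨fun i hi => ?_, fun i hi j hj => h i (Or.inr hi) j (Or.inr hj)⟩
    have := h i (Or.inr hi) (r + 2) (Or.inl rfl)
    have := hI hi
    omega
  · rintro ⟨hI, h⟩
    refine ⟨fun i hi => ?_, ?_⟩
    · have := hI hi
      omega
    · rintro i (rfl | hi) j (rfl | hj) hij
      · omega
      · have := hI hj
        omega
      · have := hI hi
        omega
      · exact h i hi j hj hij

lemma betaP_add_four (k r : ℕ) :
    betaP k (r + 4) = Xv k (r + 3) * betaP k (r + 3) + Yv k (r + 2) * betaP k (r + 2) := by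
  have hIcc : Finset.Icc 2 (r + 2) = insert (r + 2) (Finset.Icc 2 (r + 1)) := by
    ext j
    simp only [Finset.mem_insert, Finset.mem_Icc]
    omega
  rw [betaP_eq_sum_sparse k (r + 2), betaP_eq_sum_sparse k (r + 1), betaP_eq_sum_sparse k r,
    Finset.sum_filter, hIcc, Finset.sum_powerset_insert (by simp), ← Finset.sum_filter,
    ← Finset.sum_filter, filter_isSparse_insert, Finset.mul_sum, Finset.mul_sum]
  refine congrArg₂ (· + ·) (Finset.sum_congr rfl fun I hI => ?_)
    (Finset.sum_congr rfl fun I hI => ?_)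
  · exact qMono_succ k (Finset.mem_powerset.1 (Finset.mem_filter.1 hI).1)
  · exact qMono_insert k (Finset.mem_powerset.1 (Finset.mem_filter.1 hI).1)

/-- For every `k ≥ 1` and every `2 ≤ r ≤ k`, the continuant polynomials of
type `β` satisfy the recurrence `β(r+1,k) = x_r·β(r,k) + y_{r−1}·β(r−1,k)`
in `ℤ[x_1,…,x_k,y_1,…,y_k]`. -/
theorem betaP_recurrence {k : ℕ} (hk : 1 ≤ k) (r : ℕ) (hr1 : 2 ≤ r) (hr2 : r ≤ k) :
    betaP k (r + 1) = Xv k r * betaP k r + Yv k (r - 1) * betaP k (r - 1) := by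
  match r, hr1 with
  | 2, _ =>
    have h : betaP k 3 = Xv k 2 * betaP k 2 := by
      rw [betaP_eq_sum_sparse k 1, betaP_eq_sum_sparse k 0, Finset.mul_sum]
      exact Finset.sum_congr rfl fun I hI =>
        qMono_succ k (Finset.mem_powerset.1 (Finset.mem_filter.1 hI).1)
    simpa [betaP] using h
  | r + 3, _ => exact betaP_add_four k r

end
end

section
/- Let K be a commutative unital ring, k ≥ 1, m ≥ 1, and ā, b̄, c̄ ∈ K^k. Set d_i := b_i·c_i for 1 ≤ i ≤ k, d̄ := (d_1,…,d_k) and d := d_1⋯d_k. Then for n = m·k + (k−1), the determinant det(T^k_n(ā,b̄,c̄)) is a multiple of det(T^k_{k−1}(ā,b̄,c̄)); precisely, det(T^k_{mk+k−1}(ā,b̄,c̄)) = U_{m+1}(π^{ā,−d̄}(k,k), d) · det(T^k_{k−1}(ā,b̄,c̄)). -/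
noncomputable section

/-- The solution of the three-term recurrence `z (n+2) = x (n+1) * z (n+1) + y n * z n` with
initial values `u` and `v`. -/
def recSol {R : Type*} [CommRing R] (x y : ℕ → R) (u v : R) : ℕ → R
  | 0 => u
  | 1 => v
  | n + 2 => x (n + 1) * recSol x y u v (n + 1) + y n * recSol x y u v n

section Recurrence

variable {R : Type*} [CommRing R] (x y : ℕ → R)

theorem recSol_add_two (u v : R) (n : ℕ) :
    recSol x y u v (n + 2) = x (n + 1) * recSol x y u v (n + 1) + y n * recSol x y u v n :=
  rfl

theorem eq_recSol (z : ℕ → R) (hz : ∀ n, z (n + 2) = x (n + 1) * z (n + 1) + y n * z n) (n : ℕ) :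
    z n = z 0 * recSol x y 1 0 n + z 1 * recSol x y 0 1 n := by
  induction n using Nat.twoStepInduction with
  | zero => simp [recSol]
  | one => simp [recSol]
  | more n h₀ h₁ =>
    rw [hz, h₀, h₁]
    simp only [recSol]
    ring

theorem recSol_add_period {k : ℕ} (hx : ∀ n, x (n + k) = x n) (hy : ∀ n, y (n + k) = y n)
    (u v : R) (n : ℕ) :
    recSol x y u v (n + k) = recSol x y u v k * recSol x y 1 0 n +
      recSol x y u v (k + 1) * recSol x y 0 1 n := by
  have h := eq_recSol x y (fun n => recSol x y u v (n + k)) (fun n => by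
    rw [show n + 2 + k = n + k + 2 by ring, recSol, ← hx (n + 1), ← hy n,
      show n + 1 + k = n + k + 1 by ring]) n
  simpa [add_comm 1 k] using h

theorem recSol_wronskian (n : ℕ) :
    recSol x y 1 0 n * recSol x y 0 1 (n + 1) - recSol x y 1 0 (n + 1) * recSol x y 0 1 n =
      ∏ i ∈ Finset.range n, -y i := by
  induction n with
  | zero => simp [recSol]
  | succ n ih =>
    rw [Finset.prod_range_succ, ← ih]
    simp only [recSol]
    ring

theorem recSol_add_two_periods {k : ℕ} (hx : ∀ n, x (n + k) = x n) (hy : ∀ n, y (n + k) = y n)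
    (n : ℕ) :
    recSol x y 0 1 (n + k + k) =
      (recSol x y 0 1 (k + 1) + recSol x y 1 0 k) * recSol x y 0 1 (n + k) -
        (∏ i ∈ Finset.range k, -y i) * recSol x y 0 1 n := by
  rw [← recSol_wronskian]
  have h₁ := recSol_add_period x y hx hy 0 1 (n + k)
  have h₂ := recSol_add_period x y hx hy 1 0 n
  have h₃ := recSol_add_period x y hx hy 0 1 n
  linear_combination h₁ + recSol x y 0 1 k * h₂ - recSol x y 1 0 k * h₃

end Recurrence

section GenFib

variable {R : Type*} [CommRing R] (x y : R)

theorem genFib_succ_eq_sum (m N : ℕ) (hN : m / 2 < N) :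
    genFib x y (m + 1) = ∑ i ∈ Finset.range N,
      (-1 : R) ^ i * (Nat.choose (m - i) i : R) * x ^ (m - 2 * i) * y ^ i := by
  rw [genFib]
  refine Finset.sum_subset (Finset.range_subset_range.2 hN) fun i _ hi => ?_
  rw [Finset.mem_range] at hi
  rw [Nat.choose_eq_zero_of_lt (by omega)]
  simp

theorem genFib_add_two (m : ℕ) :
    genFib x y (m + 2) = x * genFib x y (m + 1) - y * genFib x y m := by
  cases m with
  | zero => simp [genFib]
  | succ m =>
    rw [genFib_succ_eq_sum x y (m + 2) (m + 2) (by omega),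
      genFib_succ_eq_sum x y (m + 1) (m + 2) (by omega),
      genFib_succ_eq_sum x y m (m + 1) (by omega), Finset.sum_range_succ', Finset.sum_range_succ' _
      (m + 1), mul_add, Finset.mul_sum, Finset.mul_sum, add_sub_right_comm,
      ← Finset.sum_sub_distrib]
    congr 1
    · refine Finset.sum_congr rfl fun i hi => ?_
      rw [Finset.mem_range] at hi
      rw [show m + 2 - (i + 1) = m - i + 1 by omega, show m + 1 - (i + 1) = m - i by omega,
        Nat.choose_succ_succ, show m + 2 - 2 * (i + 1) = m - 2 * i by omega]
      rcases lt_or_ge m (2 * i + 1) with h | h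
      · rw [Nat.choose_eq_zero_of_lt (show m - i < i.succ by omega)]
        push_cast
        ring
      · rw [show m - 2 * i = m + 1 - 2 * (i + 1) + 1 by omega]
        push_cast
        ring
    · simp
      ring

theorem eq_genFib_mul (z : ℕ → R) (h₀ : z 0 = 0)
    (hz : ∀ n, z (n + 2) = x * z (n + 1) - y * z n) (n : ℕ) : z n = genFib x y n * z 1 := by
  induction n using Nat.twoStepInduction with
  | zero => simp [genFib, h₀]
  | one => simp [genFib]
  | more n ih₀ ih₁ =>
    rw [hz, ih₀, ih₁, genFib_add_two]
    ring

end GenFib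

theorem IsSparse.two_mul_card_le {I : Finset ℕ} (hI : IsSparse I) {s r : ℕ}
    (h : I ⊆ Finset.Ico s r) : 2 * I.card ≤ r + 1 - s := by
  have hd : Disjoint I (I.image (· + 1)) := by
    rw [Finset.disjoint_left]
    intro i hi hi'
    obtain ⟨j, hj, rfl⟩ := Finset.mem_image.1 hi'
    have := hI j hj _ hi (by omega)
    omega
  have hsub : I ∪ I.image (· + 1) ⊆ Finset.Ico s (r + 1) := by
    intro i hi
    simp only [Finset.mem_union, Finset.mem_image] at hi
    rw [Finset.mem_Ico]
    rcases hi with hi | ⟨j, hj, rfl⟩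
    · have := Finset.mem_Ico.1 (h hi)
      omega
    · have := Finset.mem_Ico.1 (h hj)
      omega
  have := Finset.card_le_card hsub
  rw [Finset.card_union_of_disjoint hd, Finset.card_image_of_injective _ (add_left_injective 1),
    Nat.card_Ico] at this
  omega

theorem isSparse_insert_iff {I : Finset ℕ} {s r : ℕ} (h : I ⊆ Finset.Ico s (r + 1)) :
    IsSparse (insert (r + 1) I) ↔ IsSparse I ∧ r ∉ I := by
  constructor
  · intro hI
    refine ⟨fun i hi j hj => hI i (by simp [hi]) j (by simp [hj]), fun hr => ?_⟩
    have := hI r (by simp [hr]) (r + 1) (by simp) (by omega)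
    omega
  · rintro ⟨hI, hr⟩ i hi j hj hij
    rw [Finset.mem_insert] at hi hj
    rcases hi with rfl | hi <;> rcases hj with rfl | hj
    · omega
    · have := Finset.mem_Ico.1 (h hj)
      omega
    · have := Finset.mem_Ico.1 (h hi)
      have : i ≠ r := fun h => hr (h ▸ hi)
      omega
    · exact hI i hi j hj hij

/-- The product `x_s ⋯ x_r` with each pair `x_i x_{i+1}`, `i ∈ I`, replaced by `y_i`. -/
def sparseMonomial {R : Type*} [CommRing R] (x y : ℕ → R) (s r : ℕ) (I : Finset ℕ) : R :=
  (∏ i ∈ I, y i) * ∏ j ∈ (Finset.Icc s r).filter (fun j => j ∉ I ∧ j - 1 ∉ I), x j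

open scoped Classical in
/-- The continuant of `x_s, …, x_r`, as a sum over sparse subsets of `{s, …, r - 1}`. -/
def sparseSum {R : Type*} [CommRing R] (x y : ℕ → R) (s r : ℕ) : R :=
  ∑ I ∈ (Finset.Ico s r).powerset with IsSparse I, sparseMonomial x y s r I

section Sparse

variable {R : Type*} [CommRing R] (x y : ℕ → R)

theorem sparseMonomial_succ {s r : ℕ} (hs : s ≤ r + 1) {I : Finset ℕ}
    (hI : I ⊆ Finset.Ico s r) :
    sparseMonomial x y s (r + 1) I = x (r + 1) * sparseMonomial x y s r I := by
  have h₁ : r + 1 ∉ I := fun h => by have := Finset.mem_Ico.1 (hI h); omega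
  have h₂ : r ∉ I := fun h => by have := Finset.mem_Ico.1 (hI h); omega
  rw [sparseMonomial, sparseMonomial, ← Finset.insert_Icc_right_eq_Icc_add_one hs,
    Finset.filter_insert, if_pos (by simp [h₁, h₂]), Finset.prod_insert (by simp)]
  ring

theorem sparseMonomial_insert {s r : ℕ} {I : Finset ℕ}
    (hI : I ⊆ Finset.Ico s r) :
    sparseMonomial x y s (r + 2) (insert (r + 1) I) = y (r + 1) * sparseMonomial x y s r I := by
  have h₁ : r + 1 ∉ I := fun h => by have := Finset.mem_Ico.1 (hI h); omega
  have h₂ : (Finset.Icc s (r + 2)).filter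
      (fun j => j ∉ insert (r + 1) I ∧ j - 1 ∉ insert (r + 1) I) =
      (Finset.Icc s r).filter (fun j => j ∉ I ∧ j - 1 ∉ I) := by
    ext j
    simp only [Finset.mem_filter, Finset.mem_Icc, Finset.mem_insert, not_or]
    constructor
    · rintro ⟨_, ⟨_, h⟩, _, h'⟩
      exact ⟨⟨by omega, by omega⟩, h, h'⟩
    · rintro ⟨_, h, h'⟩
      exact ⟨⟨by omega, by omega⟩, ⟨by omega, h⟩, by omega, h'⟩
  rw [sparseMonomial, sparseMonomial, h₂, Finset.prod_insert h₁]
  ring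

theorem sparseSum_of_le {s r : ℕ} (h : r ≤ s) :
    sparseSum x y s r = ∏ j ∈ (Finset.Icc s r), x j := by
  have : IsSparse ∅ := by simp [IsSparse]
  simp [sparseSum, Finset.Ico_eq_empty_of_le h, Finset.filter_singleton, this, sparseMonomial]

theorem sparseSum_add_two {s r : ℕ} (h : s ≤ r + 1) :
    sparseSum x y s (r + 2) =
      x (r + 2) * sparseSum x y s (r + 1) + y (r + 1) * sparseSum x y s r := by
  classical
  simp only [sparseSum, Finset.sum_filter]
  rw [show Finset.Ico s (r + 2) = insert (r + 1) (Finset.Ico s (r + 1)) from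
    (Finset.insert_Ico_right_eq_Ico_add_one h).symm, Finset.sum_powerset_insert (by simp),
    Finset.mul_sum]
  congr 1
  · refine Finset.sum_congr rfl fun I hI => ?_
    rw [sparseMonomial_succ x y (by omega) (Finset.mem_powerset.1 hI), mul_ite, mul_zero]
  · rw [← Finset.sum_filter, ← Finset.sum_filter, Finset.mul_sum]
    have : ((Finset.Ico s (r + 1)).powerset.filter fun I => IsSparse (insert (r + 1) I)) =
        (Finset.Ico s r).powerset.filter IsSparse := by
      ext I
      simp only [Finset.mem_filter, Finset.mem_powerset]
      constructor
      · rintro ⟨hI, hI'⟩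
        obtain ⟨hI', hr⟩ := (isSparse_insert_iff hI).1 hI'
        refine ⟨fun i hi => ?_, hI'⟩
        have := Finset.mem_Ico.1 (hI hi)
        have : i ≠ r := fun h => hr (h ▸ hi)
        exact Finset.mem_Ico.2 (by omega)
      · rintro ⟨hI, hI'⟩
        have hI₂ : I ⊆ Finset.Ico s (r + 1) :=
          hI.trans (Finset.Ico_subset_Ico_right (by omega))
        exact ⟨hI₂, (isSparse_insert_iff hI₂).2 ⟨hI', fun h => by
          have := Finset.mem_Ico.1 (hI h); omega⟩⟩
    rw [this]
    refine Finset.sum_congr rfl fun I hI => ?_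
    exact sparseMonomial_insert x y (Finset.mem_powerset.1 (Finset.mem_filter.1 hI).1)

theorem sparseSum_one_eq_recSol (n : ℕ) : sparseSum x y 1 n = recSol x y 0 1 (n + 1) := by
  induction n using Nat.twoStepInduction with
  | zero => simp [sparseSum_of_le, recSol]
  | one => simp [sparseSum_of_le, recSol]
  | more n h₀ h₁ => rw [sparseSum_add_two x y (by omega), h₀, h₁, ← recSol_add_two x y 0 1 (n + 1)]

theorem mul_sparseSum_two_eq_recSol (n : ℕ) :
    y 0 * sparseSum x y 2 (n + 1) = recSol x y 1 0 (n + 2) := by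
  induction n using Nat.twoStepInduction with
  | zero => simp [sparseSum_of_le, recSol]
  | one => simp [sparseSum_of_le, recSol, mul_comm]
  | more n h₀ h₁ =>
    rw [sparseSum_add_two x y (by omega), recSol, ← h₀, ← h₁]
    ring

theorem map_sparseSum {S : Type*} [CommRing S] (f : R →+* S) (s r : ℕ) :
    f (sparseSum x y s r) = sparseSum (fun i => f (x i)) (fun i => f (y i)) s r := by
  simp [sparseSum, sparseMonomial, map_sum, map_prod]

theorem sum_C2_eq_sum_sparse {M : Type*} [AddCommMonoid M] (f : Finset ℕ → M) {s t N : ℕ}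
    (h : t + 2 - s < 2 * N) :
    ∑ m ∈ Finset.range N, ∑ I ∈ C2 (Finset.Icc s t) m, f I =
      open scoped Classical in
      ∑ I ∈ (Finset.Ico s (t + 1)).powerset with IsSparse I, f I := by
  classical
  rw [← Finset.sum_fiberwise_of_maps_to (t := Finset.range N) (g := Finset.card)]
  · refine Finset.sum_congr rfl fun m _ => Finset.sum_congr ?_ fun _ _ => rfl
    ext I
    simp only [C2, Finset.mem_filter, Finset.mem_powersetCard, Finset.mem_powerset,
      ← Finset.Ico_add_one_right_eq_Icc]
    rw [IsSparse]
    tauto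
  · intro I hI
    rw [Finset.mem_filter, Finset.mem_powerset] at hI
    have := hI.2.two_mul_card_le hI.1
    rw [Finset.mem_range]
    omega

end Sparse

theorem alphaComb_eq_sparseSum (k r : ℕ) : alphaComb k r = sparseSum (Xv k) (Yv k) 1 r := by
  rw [alphaComb, sum_C2_eq_sum_sparse _ (by omega), sparseSum]
  have : Finset.Ico 1 (r - 1 + 1) = Finset.Ico 1 r := by
    ext i
    simp only [Finset.mem_Ico]
    omega
  rw [this]
  rfl

theorem betaP_add_two_eq_sparseSum (k r : ℕ) :
    betaP k (r + 2) = Yv k k * sparseSum (Xv k) (Yv k) 2 (r + 1) := by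
  rw [betaP, sum_C2_eq_sum_sparse _ (by omega), sparseSum, Finset.mul_sum]
  refine Finset.sum_congr rfl fun I _ => ?_
  rw [qMono, sparseMonomial, mul_assoc]
  rfl

theorem aeval_piP_self {K : Type*} [CommRing K] {k : ℕ} (hk : 1 ≤ k) (a e : ZMod k → K) :
    MvPolynomial.aeval (Sum.elim a e) (piP k k) =
      recSol (fun i => a i) (fun i => e i) 0 1 (k + 1) +
        recSol (fun i => a i) (fun i => e i) 1 0 k := by
  have hx : ∀ i, MvPolynomial.aeval (Sum.elim a e) (Xv k i) = a i := fun i => by simp [Xv]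
  have hy : ∀ i, MvPolynomial.aeval (Sum.elim a e) (Yv k i) = e i := fun i => by simp [Yv]
  have hG : ∀ s r, MvPolynomial.aeval (Sum.elim a e) (sparseSum (Xv k) (Yv k) s r) =
      sparseSum (fun i => a i) (fun i => e i) s r := fun s r => by
    have := map_sparseSum (Xv k) (Yv k)
      (MvPolynomial.aeval (R := ℤ) (Sum.elim a e)).toRingHom s r
    simpa [hx, hy] using this
  rw [piP, map_add, alphaN, dif_pos le_rfl, alphaComb_eq_sparseSum, hG, sparseSum_one_eq_recSol]
  congr 1
  obtain _ | _ | r := k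
  · omega
  · simp [betaP, recSol]
  · rw [betaP_add_two_eq_sparseSum, map_mul, hG, hy, ← mul_sparseSum_two_eq_recSol]
    simp only [ZMod.natCast_self, Nat.cast_zero]

section Determinant

variable {K : Type*} [CommRing K] (k : ℕ) (a b c : ZMod k → K)

theorem triToeplitz_submatrix_castSucc (n : ℕ) :
    (triToeplitz k (n + 1) a b c).submatrix Fin.castSucc Fin.castSucc =
      triToeplitz k n a b c := by
  ext i j
  simp [triToeplitz]

theorem det_triToeplitz_add_two (n : ℕ) :
    (triToeplitz k (n + 2) a b c).det =
      a ((n + 2 : ℕ) : ZMod k) * (triToeplitz k (n + 1) a b c).det -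
        b ((n + 1 : ℕ) : ZMod k) * c ((n + 1 : ℕ) : ZMod k) * (triToeplitz k n a b c).det := by
  have hminor : ((triToeplitz k (n + 2) a b c).submatrix Fin.castSucc
      (Fin.succAbove (Fin.last n).castSucc)).det =
      b ((n + 1 : ℕ) : ZMod k) * (triToeplitz k n a b c).det := by
    rw [Matrix.det_succ_column _ (Fin.last n), Fin.sum_univ_castSucc, Finset.sum_eq_zero]
    · have hsub : ((triToeplitz k (n + 2) a b c).submatrix Fin.castSucc
          (Fin.succAbove (Fin.last n).castSucc)).submatrix Fin.castSucc Fin.castSucc =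
          triToeplitz k n a b c := by
        ext i j
        have : (Fin.last n).castSucc.succAbove j.castSucc = j.castSucc.castSucc :=
          Fin.succAbove_castSucc_of_lt _ _ (Fin.castSucc_lt_last j)
        simp [triToeplitz, this]
      simp only [Fin.succAbove_last, hsub]
      simp [triToeplitz, ← two_mul, pow_mul]
    · intro i _
      have := i.isLt
      simp [triToeplitz, show ¬ (i : ℕ) = n + 1 by omega, show ¬ n = (i : ℕ) by omega,
        show ¬ (i : ℕ) = n + 1 + 1 by omega]
  rw [Matrix.det_succ_row _ (Fin.last (n + 1)), Fin.sum_univ_castSucc, Fin.sum_univ_castSucc,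
    Finset.sum_eq_zero]
  · simp only [Fin.succAbove_last, hminor, triToeplitz_submatrix_castSucc]
    have hc : triToeplitz k (n + 2) a b c (Fin.last (n + 1)) (Fin.last n).castSucc =
        c ((n + 1 : ℕ) : ZMod k) := by
      simp [triToeplitz, show ¬ n = n + 1 + 1 by omega]
    have ha : triToeplitz k (n + 2) a b c (Fin.last (n + 1)) (Fin.last (n + 1)) =
        a ((n + 2 : ℕ) : ZMod k) := by
      simp [triToeplitz, add_assoc, one_add_one_eq_two]
    simp only [ha, hc, Fin.val_last, Fin.val_castSucc, zero_add]
    rw [Odd.neg_one_pow ⟨n, by ring⟩,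
      Even.neg_one_pow ⟨n + 1, rfl⟩]
    ring
  · intro i _
    have := i.isLt
    simp [triToeplitz, show ¬ n + 1 = (i : ℕ) by omega, show ¬ n = (i : ℕ) by omega,
      show ¬ (i : ℕ) = n + 1 + 1 by omega]

theorem det_triToeplitz_eq_recSol (n : ℕ) :
    (triToeplitz k n a b c).det =
      recSol (fun i => a i) (fun i => -(b i * c i)) 0 1 (n + 1) := by
  induction n using Nat.twoStepInduction with
  | zero => simp [recSol]
  | one => simp [recSol, triToeplitz]
  | more n h₀ h₁ =>
    rw [det_triToeplitz_add_two, h₀, h₁, recSol_add_two _ _ 0 1 (n + 1)]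
    ring

end Determinant

/-- **Factorization of the determinant in the case `r = k−1`.**
Let `K` be a commutative unital ring, `k ≥ 1`, `m ≥ 1`, and `ā, b̄, c̄ ∈ K^k`.
Set `d_i := b_i·c_i` and `d := d_1⋯d_k`. Then for `n = m·k + (k−1)`, the
determinant `det(T^k_n(ā,b̄,c̄))` is a multiple of `det(T^k_{k−1}(ā,b̄,c̄))`;
precisely,
`det(T^k_{mk+k−1}(ā,b̄,c̄)) = U_{m+1}(π^{ā,−d̄}(k,k), d) · det(T^k_{k−1}(ā,b̄,c̄))`. -/
theorem det_triToeplitz_factorization {K : Type*} [CommRing K] {k m : ℕ}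
    (hk : 1 ≤ k) (hm : 1 ≤ m) (a b c : ZMod k → K)
    (d : ZMod k → K) (hd : ∀ i, d i = b i * c i)
    (dtot : K) (hdtot : dtot = ∏ p ∈ Finset.Icc 1 k, d ((p : ℕ) : ZMod k)) :
    (triToeplitz k (m * k + (k - 1)) a b c).det =
      genFib (MvPolynomial.aeval (Sum.elim a fun i => -d i) (piP k k)) dtot (m + 1) *
        (triToeplitz k (k - 1) a b c).det := by
  obtain rfl : d = fun i => b i * c i := funext hd
  set x : ℕ → K := fun i => a i
  set y : ℕ → K := fun i => -(b i * c i)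
  have hx : ∀ n, x (n + k) = x n := fun n => by simp [x]
  have hy : ∀ n, y (n + k) = y n := fun n => by simp [y]
  have hprod : dtot = ∏ i ∈ Finset.range k, -y i := by
    obtain ⟨k, rfl⟩ : ∃ l, k = l + 1 := ⟨k - 1, by omega⟩
    rw [hdtot, ← Finset.Ico_add_one_right_eq_Icc, Finset.prod_Ico_eq_prod_range,
      Nat.add_sub_cancel, Finset.prod_range_succ, Finset.prod_range_succ']
    simp [y, add_comm]
  have key := eq_genFib_mul (recSol x y 0 1 (k + 1) + recSol x y 1 0 k) dtot
    (fun n => recSol x y 0 1 (n * k)) (by simp [recSol]) (fun n => by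
      rw [hprod, add_mul n 2, add_mul n 1, two_mul, one_mul, ← add_assoc]
      exact recSol_add_two_periods x y hx hy (n * k)) (m + 1)
  rw [det_triToeplitz_eq_recSol, det_triToeplitz_eq_recSol, aeval_piP_self hk,
    show m * k + (k - 1) + 1 = (m + 1) * k by rw [add_mul]; omega, Nat.sub_add_cancel hk]
  simpa using key

end
end

section
/- For every integer k ≥ 1 and every 0 ≤ r < k, the continuant polynomials satisfy α(k+r,k) = α(k,k)·α(r,k) + α(k−1,k)·β(r+1,k) in ℤ[x_1,…,x_k,y_1,…,y_k]. -/
noncomputable section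

/-- Subsets of `S` without two consecutive elements. -/
def sparseSubsets (S : Finset ℕ) : Finset (Finset ℕ) :=
  S.powerset.filter fun I => ∀ i ∈ I, ∀ j ∈ I, i < j → i + 2 ≤ j

/-- The monomial obtained from `x_{a+1} ⋯ x_{a+n}` by replacing, for each `i ∈ I`, the pair
`x_i x_{i+1}` by `y_i`. -/
def segmentMono (k a n : ℕ) (I : Finset ℕ) : ContRing k :=
  (∏ i ∈ I, Yv k i) *
    ∏ j ∈ (Finset.Icc (a + 1) (a + n)).filter (fun j => j ∉ I ∧ j - 1 ∉ I), Xv k j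

/-- The continuant of the variables `x_{a+1}, …, x_{a+n}`. -/
def segmentContinuant (k a n : ℕ) : ContRing k :=
  ∑ I ∈ sparseSubsets (Finset.Icc (a + 1) (a + n - 1)), segmentMono k a n I

theorem mem_sparseSubsets {S I : Finset ℕ} :
    I ∈ sparseSubsets S ↔ I ⊆ S ∧ ∀ i ∈ I, ∀ j ∈ I, i < j → i + 2 ≤ j := by
  simp [sparseSubsets]

theorem card_le_of_mem_sparseSubsets {a n : ℕ} {I : Finset ℕ}
    (hI : I ∈ sparseSubsets (Finset.Icc (a + 1) (a + n - 1))) : I.card ≤ n / 2 := by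
  rw [mem_sparseSubsets] at hI
  obtain ⟨hsub, hsep⟩ := hI
  have hdisj : Disjoint I (I.image Nat.succ) := by
    rw [Finset.disjoint_left]
    intro x hx hx'
    obtain ⟨y, hy, rfl⟩ := Finset.mem_image.1 hx'
    have := hsep y hy _ hx (Nat.lt_succ_self y)
    omega
  have hunion : I ∪ I.image Nat.succ ⊆ Finset.Icc (a + 1) (a + n) := by
    intro x hx
    rcases Finset.mem_union.1 hx with h | h
    · have := Finset.mem_Icc.1 (hsub h)
      exact Finset.mem_Icc.2 (by omega)
    · obtain ⟨y, hy, rfl⟩ := Finset.mem_image.1 h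
      have := Finset.mem_Icc.1 (hsub hy)
      exact Finset.mem_Icc.2 (by omega)
  have hcard := Finset.card_le_card hunion
  rw [Finset.card_union_of_disjoint hdisj,
    Finset.card_image_of_injective _ Nat.succ_injective, Nat.card_Icc] at hcard
  omega

theorem sum_C2_eq_sum_sparseSubsets {M : Type*} [AddCommMonoid M] (a n : ℕ)
    (f : Finset ℕ → M) :
    ∑ m ∈ Finset.range (n / 2 + 1), ∑ I ∈ C2 (Finset.Icc (a + 1) (a + n - 1)) m, f I =
      ∑ I ∈ sparseSubsets (Finset.Icc (a + 1) (a + n - 1)), f I := by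
  rw [← Finset.sum_fiberwise_of_maps_to (g := Finset.card) (t := Finset.range (n / 2 + 1))]
  · refine Finset.sum_congr rfl fun m _ => Finset.sum_congr ?_ fun _ _ => rfl
    ext I
    simp only [C2, Finset.mem_filter, Finset.mem_powersetCard, mem_sparseSubsets]
    tauto
  · intro I hI
    have := card_le_of_mem_sparseSubsets hI
    exact Finset.mem_range.2 (by omega)

theorem alphaComb_eq_segmentContinuant (k r : ℕ) :
    alphaComb k r = segmentContinuant k 0 r := by
  have h := sum_C2_eq_sum_sparseSubsets 0 r (pMono k r)
  simp only [zero_add] at h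
  refine h.trans ?_
  simp only [segmentContinuant, segmentMono, pMono, zero_add]

theorem betaP_eq_segmentContinuant (k r : ℕ) :
    betaP k (r + 2) = Yv k k * segmentContinuant k 1 r := by
  have h := sum_C2_eq_sum_sparseSubsets 1 r (qMono k (r + 2))
  have hr : 1 + r - 1 = r := by omega
  have hr' : r + 2 - 1 = 1 + r := by omega
  rw [hr] at h
  simp only [betaP, segmentContinuant, hr, Finset.mul_sum]
  refine h.trans (Finset.sum_congr rfl fun I _ => ?_)
  simp only [qMono, segmentMono, hr', mul_assoc]

theorem sparseSubsets_Icc_of_lt {a b : ℕ} (h : b < a) :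
    sparseSubsets (Finset.Icc a b) = {∅} := by
  rw [Finset.Icc_eq_empty_of_lt h, sparseSubsets, Finset.powerset_empty,
    Finset.filter_singleton, if_pos (by simp)]

theorem segmentContinuant_zero (k a : ℕ) : segmentContinuant k a 0 = 1 := by
  rw [segmentContinuant, sparseSubsets_Icc_of_lt (by omega)]
  simp [segmentMono]

theorem segmentContinuant_one (k a : ℕ) : segmentContinuant k a 1 = Xv k (a + 1) := by
  rw [segmentContinuant, sparseSubsets_Icc_of_lt (by omega)]
  simp [segmentMono]

theorem sparseSubsets_Icc_succ_succ (a n : ℕ) :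
    sparseSubsets (Finset.Icc (a + 1) (a + n + 1)) =
      sparseSubsets (Finset.Icc (a + 1) (a + n)) ∪
        (sparseSubsets (Finset.Icc (a + 1) (a + n - 1))).image (insert (a + n + 1)) := by
  ext I
  simp only [Finset.mem_union, Finset.mem_image, mem_sparseSubsets]
  constructor
  · rintro ⟨hsub, hsep⟩
    by_cases h : a + n + 1 ∈ I
    · refine Or.inr ⟨I.erase (a + n + 1), ⟨fun i hi => ?_, fun i hi j hj => ?_⟩,
        Finset.insert_erase h⟩
      · obtain ⟨hne, hi⟩ := Finset.mem_erase.1 hi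
        have h1 := Finset.mem_Icc.1 (hsub hi)
        have h2 := hsep i hi _ h (by omega)
        exact Finset.mem_Icc.2 (by omega)
      · exact hsep i (Finset.mem_of_mem_erase hi) j (Finset.mem_of_mem_erase hj)
    · refine Or.inl ⟨fun i hi => ?_, hsep⟩
      have h1 := Finset.mem_Icc.1 (hsub hi)
      have h2 : i ≠ a + n + 1 := fun e => h (e ▸ hi)
      exact Finset.mem_Icc.2 (by omega)
  · rintro (⟨hsub, hsep⟩ | ⟨J, ⟨hsub, hsep⟩, rfl⟩)
    · exact ⟨hsub.trans (Finset.Icc_subset_Icc_right (by omega)), hsep⟩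
    · refine ⟨fun i hi => ?_, fun i hi j hj hij => ?_⟩
      · rcases Finset.mem_insert.1 hi with rfl | hi
        · exact Finset.mem_Icc.2 (by omega)
        · have := Finset.mem_Icc.1 (hsub hi)
          exact Finset.mem_Icc.2 (by omega)
      · rcases Finset.mem_insert.1 hi with rfl | hi <;> rcases Finset.mem_insert.1 hj with rfl | hj
        · omega
        · have := Finset.mem_Icc.1 (hsub hj)
          omega
        · have := Finset.mem_Icc.1 (hsub hi)
          omega
        · exact hsep i hi j hj hij

theorem notMem_of_mem_sparseSubsets_Icc {a b c : ℕ} {I : Finset ℕ}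
    (hI : I ∈ sparseSubsets (Finset.Icc a b)) (hc : b < c) : c ∉ I := fun h => by
  have := Finset.mem_Icc.1 ((mem_sparseSubsets.1 hI).1 h)
  omega

theorem segmentMono_succ {k a n : ℕ} {I : Finset ℕ}
    (hI : I ∈ sparseSubsets (Finset.Icc (a + 1) (a + n))) :
    segmentMono k a (n + 2) I = Xv k (a + n + 2) * segmentMono k a (n + 1) I := by
  have h1 := notMem_of_mem_sparseSubsets_Icc hI (c := a + n + 1) (by omega)
  have h2 := notMem_of_mem_sparseSubsets_Icc hI (c := a + n + 2) (by omega)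
  have hset : (Finset.Icc (a + 1) (a + (n + 2))).filter (fun j => j ∉ I ∧ j - 1 ∉ I) =
      insert (a + n + 2)
        ((Finset.Icc (a + 1) (a + (n + 1))).filter (fun j => j ∉ I ∧ j - 1 ∉ I)) := by
    rw [← add_assoc a n 1, show a + (n + 2) = a + n + 1 + 1 by omega,
      ← Finset.insert_Icc_right_eq_Icc_add_one (by omega : a + 1 ≤ a + n + 1 + 1),
      Finset.filter_insert, if_pos ⟨h2, by simpa using h1⟩]
    rfl
  rw [segmentMono, segmentMono, hset, Finset.prod_insert (by simp; omega)]
  ring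

theorem segmentMono_insert {k a n : ℕ} {I : Finset ℕ}
    (hI : I ∈ sparseSubsets (Finset.Icc (a + 1) (a + n - 1))) :
    segmentMono k a (n + 2) (insert (a + n + 1) I) =
      Yv k (a + n + 1) * segmentMono k a n I := by
  have h1 : a + n + 1 ∉ I := notMem_of_mem_sparseSubsets_Icc hI (by omega)
  have hset : (Finset.Icc (a + 1) (a + (n + 2))).filter
        (fun j => j ∉ insert (a + n + 1) I ∧ j - 1 ∉ insert (a + n + 1) I) =
      (Finset.Icc (a + 1) (a + n)).filter (fun j => j ∉ I ∧ j - 1 ∉ I) := by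
    ext j
    simp only [Finset.mem_filter, Finset.mem_Icc, Finset.mem_insert, not_or]
    constructor
    · rintro ⟨h, ⟨h3, h4⟩, h5, h6⟩
      exact ⟨by omega, h4, h6⟩
    · rintro ⟨h, h3, h4⟩
      exact ⟨by omega, ⟨by omega, h3⟩, by omega, h4⟩
  rw [segmentMono, segmentMono, hset, Finset.prod_insert h1, mul_assoc]

theorem segmentContinuant_add_two (k a n : ℕ) :
    segmentContinuant k a (n + 2) =
      Xv k (a + n + 2) * segmentContinuant k a (n + 1) +
        Yv k (a + n + 1) * segmentContinuant k a n := by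
  have e1 : a + (n + 2) - 1 = a + n + 1 := by omega
  have e2 : a + (n + 1) - 1 = a + n := by omega
  simp only [segmentContinuant, e1, e2]
  rw [sparseSubsets_Icc_succ_succ, Finset.sum_union, Finset.sum_image, Finset.mul_sum,
    Finset.mul_sum]
  · congr 1
    · exact Finset.sum_congr rfl fun I hI => segmentMono_succ hI
    · exact Finset.sum_congr rfl fun I hI => segmentMono_insert hI
  · intro I hI J hJ h
    have hI' : a + n + 1 ∉ I := notMem_of_mem_sparseSubsets_Icc hI (by omega)
    have hJ' : a + n + 1 ∉ J := notMem_of_mem_sparseSubsets_Icc hJ (by omega)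
    rw [← Finset.erase_insert hI', ← Finset.erase_insert hJ']
    exact congrArg (Finset.erase · (a + n + 1)) h
  · rw [Finset.disjoint_left]
    intro I hI hI'
    obtain ⟨J, -, rfl⟩ := Finset.mem_image.1 hI'
    exact notMem_of_mem_sparseSubsets_Icc hI (by omega) (Finset.mem_insert_self (a + n + 1) J)

theorem alphaN_of_le {k n : ℕ} (h : n ≤ k) : alphaN k n = segmentContinuant k 0 n := by
  rw [alphaN, dif_pos h, alphaComb_eq_segmentContinuant]

theorem alphaN_add_two {k n : ℕ} (h : k < n + 2) :
    alphaN k (n + 2) = Xv k (n + 2) * alphaN k (n + 1) + Yv k (n + 1) * alphaN k n := by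
  rw [alphaN, dif_neg (by omega)]
  rfl

theorem Xv_add_period (k i : ℕ) : Xv k (k + i) = Xv k i := by
  simp [Xv]

theorem Yv_add_period (k i : ℕ) : Yv k (k + i) = Yv k i := by
  simp [Yv]

theorem betaP_add_three (k r : ℕ) :
    betaP k (r + 3) = Xv k (r + 2) * betaP k (r + 2) + Yv k (r + 1) * betaP k (r + 1) := by
  cases r with
  | zero =>
    rw [betaP_eq_segmentContinuant k 1, betaP_eq_segmentContinuant k 0, segmentContinuant_zero,
      segmentContinuant_one, betaP]
    ring
  | succ r =>
    rw [betaP_eq_segmentContinuant k (r + 2), betaP_eq_segmentContinuant k (r + 1),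
      betaP_eq_segmentContinuant k r, segmentContinuant_add_two,
      show 1 + r + 2 = r + 1 + 2 by omega, show 1 + r + 1 = r + 1 + 1 by omega]
    ring

/-- For every `k ≥ 1` and every `0 ≤ r < k`, the continuant polynomials
satisfy `α(k+r,k) = α(k,k)·α(r,k) + α(k−1,k)·β(r+1,k)` in
`ℤ[x_1,…,x_k,y_1,…,y_k]`. -/
theorem alpha_second_period {k : ℕ} (hk : 1 ≤ k) (r : ℕ) (hr : r < k) :
    alphaN k (k + r) = alphaN k k * alphaN k r + alphaN k (k - 1) * betaP k (r + 1) := by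
  induction r using Nat.strong_induction_on with
  | _ r ih =>
    match r with
    | 0 => simp [alphaN_of_le (Nat.zero_le k), segmentContinuant_zero, betaP]
    | 1 =>
      obtain ⟨m, rfl⟩ : ∃ m, k = m + 1 := ⟨k - 1, by omega⟩
      rw [show m + 1 + 1 = m + 2 from rfl, alphaN_add_two (by omega),
        show m + 2 = m + 1 + 1 from rfl, Xv_add_period, alphaN_of_le (n := 1) (by omega),
        segmentContinuant_one, betaP_eq_segmentContinuant, segmentContinuant_zero,
        Nat.add_sub_cancel, zero_add]
      ring
    | r + 2 =>
      have h1 := ih (r + 1) (by omega) (by omega)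
      have h0 := ih r (by omega) (by omega)
      have hα : alphaN k (r + 2) =
          Xv k (r + 2) * alphaN k (r + 1) + Yv k (r + 1) * alphaN k r := by
        rw [alphaN_of_le (by omega), alphaN_of_le (by omega), alphaN_of_le (by omega),
          segmentContinuant_add_two, zero_add]
      rw [← add_assoc, alphaN_add_two (by omega), add_assoc k r 2, add_assoc k r 1,
        Xv_add_period, Yv_add_period, h1, h0, hα, betaP_add_three]
      ring

end
end

section
/- Let K be a commutative unital ring, k, n ≥ 1, ā, b̄, c̄ ∈ K^k, and set d_i := b_i·c_i, d̄ := (d_1,…,d_k). Let T := T^k_n(ā,b̄,c̄) and let p_T(x) := det(x·I_n − T) be its characteristic polynomial. Let λ ∈ K and let z ∈ K with z ≠ 0 and z·p_T(λ) = 0. Define the vector v ∈ K^n by v_i := z · (∏_{j=i}^{n−1} b_j) · D^{λ̄−ā, d̄}(i−1, k) for 1 ≤ i ≤ n, where λ̄−ā := (λ−a_1,…,λ−a_k), the product over b uses the periodic extension of b̄, and the empty product equals 1. Then T·v = λ·v; in particular, if v ≠ 0 then v is an eigenvector of T associated to the eigenvalue λ. -/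
noncomputable section

/-- Three-term recurrence for the determinant of a tridiagonal `k`-Toeplitz matrix. -/
theorem triToeplitz_det_succ_succ {K : Type*} [CommRing K] (k n : ℕ) (a b c : ZMod k → K) :
    (triToeplitz k (n + 2) a b c).det =
      a ((n + 2 : ℕ) : ZMod k) * (triToeplitz k (n + 1) a b c).det -
        b ((n + 1 : ℕ) : ZMod k) * c ((n + 1 : ℕ) : ZMod k) * (triToeplitz k n a b c).det := by
  have h_last : (triToeplitz k (n + 2) a b c).submatrix Fin.castSucc Fin.castSucc =
      triToeplitz k (n + 1) a b c := by
    ext i j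
    simp [triToeplitz]
  have h_minor : ((triToeplitz k (n + 2) a b c).submatrix Fin.castSucc
      (Fin.last n).castSucc.succAbove).det =
      b ((n + 1 : ℕ) : ZMod k) * (triToeplitz k n a b c).det := by
    rw [Matrix.det_succ_column _ (Fin.last n), Fin.sum_univ_castSucc, Finset.sum_eq_zero]
    · have h_sub : ((triToeplitz k (n + 2) a b c).submatrix Fin.castSucc
          (Fin.last n).castSucc.succAbove).submatrix Fin.castSucc Fin.castSucc =
          triToeplitz k n a b c := by
        ext i j
        have hj : (Fin.last n).castSucc.succAbove j.castSucc = j.castSucc.castSucc :=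
          Fin.succAbove_of_castSucc_lt _ _ (by simp [Fin.lt_def])
        simp [triToeplitz, hj]
      simp only [Fin.succAbove_last, h_sub]
      simp [triToeplitz, ← two_mul]
    · intro i _
      have hi := i.isLt
      simp [triToeplitz, show (i : ℕ) ≠ n + 1 by omega, show n ≠ (i : ℕ) by omega,
        show (i : ℕ) ≠ n + 1 + 1 by omega]
  rw [Matrix.det_succ_row _ (Fin.last (n + 1)), Fin.sum_univ_castSucc, Fin.sum_univ_castSucc,
    Finset.sum_eq_zero]
  · simp only [Fin.succAbove_last, h_last, h_minor]
    generalize (triToeplitz k (n + 1) a b c).det = p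
    generalize (triToeplitz k n a b c).det = q
    simp [triToeplitz, ← two_mul, add_assoc]
    ring
  · intro i _
    have hi := i.isLt
    simp [triToeplitz, show n + 1 ≠ (i : ℕ) by omega, show (i : ℕ) ≠ n + 1 + 1 by omega,
      show n ≠ (i : ℕ) by omega]

theorem univDet_zero {K : Type*} [CommRing K] (k : ℕ) (a d : ZMod k → K) :
    univDet k a d 0 = 1 := by
  simp [univDet]

theorem univDet_one {K : Type*} [CommRing K] (k : ℕ) (a d : ZMod k → K) :
    univDet k a d 1 = a 1 := by
  simp [univDet, triToeplitz]

theorem univDet_succ_succ {K : Type*} [CommRing K] (k n : ℕ) (a d : ZMod k → K) :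
    univDet k a d (n + 2) =
      a ((n + 2 : ℕ) : ZMod k) * univDet k a d (n + 1) -
        d ((n + 1 : ℕ) : ZMod k) * univDet k a d n := by
  simp only [univDet, triToeplitz_det_succ_succ, one_mul]

/-- The determinant depends on the off-diagonals only through the products `b_i * c_i`. -/
theorem triToeplitz_det_eq_univDet {K : Type*} [CommRing K] (k : ℕ) (a b c d : ZMod k → K)
    (hd : ∀ i, d i = b i * c i) (n : ℕ) :
    (triToeplitz k n a b c).det = univDet k a d n := by
  induction n using Nat.twoStepInduction with
  | zero => simp [univDet]
  | one => simp [univDet, triToeplitz]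
  | more n ih₀ ih₁ => rw [triToeplitz_det_succ_succ, univDet_succ_succ, ih₀, ih₁, hd]

theorem smul_one_sub_triToeplitz {K : Type*} [CommRing K] (k n : ℕ) (a b c : ZMod k → K)
    (lam : K) :
    lam • (1 : Matrix (Fin n) (Fin n) K) - triToeplitz k n a b c =
      triToeplitz k n (fun t => lam - a t) (fun t => -b t) (fun t => -c t) := by
  ext i j
  by_cases h : i = j
  · subst h
    simp [triToeplitz]
  · have h' : (i : ℕ) ≠ j := fun e => h (Fin.ext e)
    simp only [triToeplitz, Matrix.sub_apply, Matrix.smul_apply, Matrix.one_apply_ne h,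
      Matrix.of_apply, if_neg h']
    split_ifs <;> simp

/-- A tridiagonal `k`-Toeplitz matrix acts on a vector by its three-term stencil. -/
theorem triToeplitz_mulVec_apply {K : Type*} [CommRing K] (k n : ℕ) (a b c : ZMod k → K)
    (w : ℕ → K) (i : Fin n) :
    (triToeplitz k n a b c).mulVec (fun j => w j) i =
      (if (i : ℕ) = 0 then 0 else c ((i : ℕ) : ZMod k) * w ((i : ℕ) - 1)) +
        a (((i : ℕ) + 1 : ℕ) : ZMod k) * w i +
        (if (i : ℕ) + 1 < n then b (((i : ℕ) + 1 : ℕ) : ZMod k) * w ((i : ℕ) + 1) else 0) := by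
  obtain ⟨i, hi⟩ := i
  have h_entry : ∀ j : ℕ,
      (if i = j then a ((i + 1 : ℕ) : ZMod k)
        else if j = i + 1 then b ((i + 1 : ℕ) : ZMod k)
        else if i = j + 1 then c ((j + 1 : ℕ) : ZMod k) else 0) * w j =
      (if j = i - 1 then (if i = 0 then 0 else c (i : ZMod k) * w (i - 1)) else 0) +
        (if j = i then a ((i + 1 : ℕ) : ZMod k) * w i else 0) +
        (if j = i + 1 then b ((i + 1 : ℕ) : ZMod k) * w (i + 1) else 0) := by
    intro j
    rcases Nat.lt_trichotomy j i with h | rfl | h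
    · obtain ⟨m, rfl⟩ : ∃ m, i = m + 1 := ⟨i - 1, by omega⟩
      by_cases hj : j = m
      · subst hj
        simp [show ¬ j = j + 1 + 1 by omega]
      · simp [hj, show ¬ m + 1 = j by omega, show ¬ j = m + 1 by omega,
          show ¬ j = m + 1 + 1 by omega, Ne.symm hj]
    · rcases j with _ | j <;> simp
    · by_cases hj : j = i + 1
      · subst hj
        simp [show ¬ i + 1 = i - 1 by omega]
      · simp [hj, show ¬ i = j by omega, show ¬ j = i by omega, show ¬ i = j + 1 by omega,
          show ¬ j = i - 1 by omega]
  simp only [Matrix.mulVec, dotProduct, triToeplitz, Matrix.of_apply]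
  rw [Fin.sum_univ_eq_sum_range (fun j => (if i = j then a ((i + 1 : ℕ) : ZMod k)
        else if j = i + 1 then b ((i + 1 : ℕ) : ZMod k)
        else if i = j + 1 then c ((j + 1 : ℕ) : ZMod k) else 0) * w j) n]
  simp only [h_entry, Finset.sum_add_distrib, Finset.sum_ite_eq', Finset.mem_range, hi,
    show i - 1 < n by omega, if_true]

/-- **Eigenvectors of a tridiagonal `k`-Toeplitz matrix.**
Let `K` be a commutative unital ring, `k, n ≥ 1`, `ā, b̄, c̄ ∈ K^k`, and set
`d_i := b_i·c_i`. Let `T := T^k_n(ā,b̄,c̄)` with characteristic polynomial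
`p_T(x) = det(x·I_n − T)`. Let `λ ∈ K` and `z ≠ 0` with `z·p_T(λ) = 0`.
Define `v ∈ K^n` by `v_i := z·(∏_{j=i}^{n−1} b_j)·D^{λ̄−ā,d̄}(i−1,k)`
(1-based `i`, periodic extension of `b̄`, empty product `1`). Then
`T·v = λ·v`; in particular, if `v ≠ 0` then `v` is an eigenvector of `T`
associated to the eigenvalue `λ`. -/
theorem triToeplitz_eigenvector {K : Type*} [CommRing K] {k n : ℕ}
    (hk : 1 ≤ k) (hn : 1 ≤ n) (a b c : ZMod k → K)
    (d : ZMod k → K) (hd : ∀ i, d i = b i * c i)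
    (lam z : K) (hz : z ≠ 0)
    (hzp : z * (lam • (1 : Matrix (Fin n) (Fin n) K) - triToeplitz k n a b c).det = 0)
    (v : Fin n → K)
    (hv : ∀ i : Fin n, v i =
      z * (∏ j ∈ Finset.Icc ((i : ℕ) + 1) (n - 1), b ((j : ℕ) : ZMod k)) *
        univDet k (fun t => lam - a t) d (i : ℕ)) :
    (triToeplitz k n a b c).mulVec v = lam • v := by
  have h_top : z * univDet k (fun t => lam - a t) d n = 0 := by
    rw [← triToeplitz_det_eq_univDet k _ (fun t => -b t) (fun t => -c t) d (by simp [hd]),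
      ← smul_one_sub_triToeplitz]
    exact hzp
  obtain rfl : v = fun i : Fin n => (fun m : ℕ =>
      z * (∏ j ∈ Finset.Icc (m + 1) (n - 1), b ((j : ℕ) : ZMod k)) *
        univDet k (fun t => lam - a t) d m) i := funext hv
  have h_prod : ∀ m, m + 1 < n → ∏ j ∈ Finset.Icc (m + 1) (n - 1), b ((j : ℕ) : ZMod k) =
      b ((m + 1 : ℕ) : ZMod k) *
        ∏ j ∈ Finset.Icc (m + 1 + 1) (n - 1), b ((j : ℕ) : ZMod k) := by
    intro m hm
    rw [← Finset.insert_Icc_add_one_left_eq_Icc (show m + 1 ≤ n - 1 by omega),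
      Finset.prod_insert (by simp)]
  -- The uniform form of the last term: in the bottom row it vanishes by `h_top`.
  have h_next : ∀ m, m < n → (if m + 1 < n then b ((m + 1 : ℕ) : ZMod k) *
      (z * (∏ j ∈ Finset.Icc (m + 1 + 1) (n - 1), b ((j : ℕ) : ZMod k)) *
        univDet k (fun t => lam - a t) d (m + 1)) else 0) =
      z * (∏ j ∈ Finset.Icc (m + 1) (n - 1), b ((j : ℕ) : ZMod k)) *
        univDet k (fun t => lam - a t) d (m + 1) := by
    intro m hm
    split_ifs with h
    · rw [h_prod m h]
      ring
    · obtain rfl : n = m + 1 := by omega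
      simp [h_top]
  ext ⟨i, hi⟩
  rw [triToeplitz_mulVec_apply k n a b c (fun m : ℕ =>
    z * (∏ j ∈ Finset.Icc (m + 1) (n - 1), b ((j : ℕ) : ZMod k)) *
      univDet k (fun t => lam - a t) d m)]
  simp only [Pi.smul_apply, smul_eq_mul]
  rw [h_next i hi]
  rcases i with _ | i
  · simp only [univDet_zero, univDet_one, zero_add, if_true, Nat.cast_one]
    ring
  · simp only [Nat.add_eq_zero_iff, one_ne_zero, and_false, if_false, Nat.add_sub_cancel,
      univDet_succ_succ, hd, h_prod i hi, add_assoc, Nat.reduceAdd]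
    ring

end
end

section
/- Let K be a commutative unital ring, k, n ≥ 1, ā, b̄, c̄ ∈ K^k, and set d_i := b_i·c_i for 1 ≤ i ≤ k, d̄ := (d_1,…,d_k). If Δ := D^{ā,d̄}(n,k) = det(T^k_n(ā,b̄,c̄)) is a unit of K, then T^k_n(ā,b̄,c̄) is invertible and for all 1 ≤ i, j ≤ n the (i,j) entry of its inverse equals (−1)^{i+j} · (∏_{p=i}^{j−1} b_p) · (∏_{p=j}^{i−1} c_p) · D^{ā,d̄}(min(i,j)−1, k) · D_{max(i,j)}^{ā,d̄}(n−max(i,j), k) · Δ^{−1}, where the products over b and c use the periodic extensions of b̄ and c̄ and empty products equal 1. -/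
noncomputable section

/-- The tridiagonal matrix generated by three sequences, starting at index `s`. -/
def tridiag {K : Type*} [CommRing K] (a b c : ℕ → K) (s n : ℕ) : Matrix (Fin n) (Fin n) K :=
  Matrix.of fun i j =>
    if (i : ℕ) = (j : ℕ) then a (s + i)
    else if (j : ℕ) = (i : ℕ) + 1 then b (s + i)
    else if (i : ℕ) = (j : ℕ) + 1 then c (s + j)
    else 0

/-- The continuant of `a_s, …, a_{s+m-2}`, of size `m - 1`, by expansion on the left;
the size `-1` gives `0`. -/
def leftContinuant {K : Type*} [CommRing K] (a d : ℕ → K) : ℕ → ℕ → K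
  | _, 0 => 0
  | _, 1 => 1
  | s, m + 2 => a s * leftContinuant a d (s + 1) (m + 1) - d s * leftContinuant a d (s + 2) m

/-- The continuant of `a_0, …, a_{m-2}`, of size `m - 1`, by expansion on the right;
the size `-1` gives `0`. -/
def rightContinuant {K : Type*} [CommRing K] (a d : ℕ → K) : ℕ → K
  | 0 => 0
  | 1 => 1
  | m + 2 => a m * rightContinuant a d (m + 1) - d (m - 1) * rightContinuant a d m

section Continuants

variable {K : Type*} [CommRing K]

theorem det_tridiag_add_two (a b c : ℕ → K) (s n : ℕ) :
    (tridiag a b c s (n + 2)).det = a s * (tridiag a b c (s + 1) (n + 1)).det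
      - b s * c s * (tridiag a b c (s + 2) n).det := by
  have minor : (tridiag a b c s (n + 2)).submatrix Fin.succ (Fin.succAbove 0) =
      tridiag a b c (s + 1) (n + 1) := by
    ext i j
    simp [tridiag, add_assoc, add_comm 1]
  have corner : ((tridiag a b c s (n + 2)).submatrix Fin.succ (Fin.succAbove 1)).det =
      c s * (tridiag a b c (s + 2) n).det := by
    rw [Matrix.det_succ_column_zero, Fin.sum_univ_succ, Finset.sum_eq_zero]
    · have h : (((tridiag a b c s (n + 2)).submatrix Fin.succ (Fin.succAbove 1)).submatrix
          (Fin.succAbove 0) Fin.succ) = tridiag a b c (s + 2) n := by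
        ext i j
        have hj : (Fin.succAbove (1 : Fin (n + 2)) j.succ) = j.succ.succ :=
          Fin.succAbove_of_le_castSucc _ _ (by simp [Fin.le_def])
        simp [tridiag, hj, add_assoc, add_comm 2]
      rw [h]
      simp [tridiag]
    · intro i _
      simp [tridiag]
  rw [Matrix.det_succ_row_zero, Fin.sum_univ_succ, Fin.sum_univ_succ, Finset.sum_eq_zero]
  · rw [minor]
    simp only [Fin.succ_zero_eq_one, corner]
    simp [tridiag]
    ring
  · intro i _
    simp [tridiag]

theorem det_tridiag (a b c : ℕ → K) (s n : ℕ) :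
    (tridiag a b c s n).det = leftContinuant a (fun i => b i * c i) s (n + 1) := by
  induction n using Nat.twoStepInduction generalizing s with
  | zero => simp [leftContinuant]
  | one => simp [tridiag, leftContinuant]
  | more n h₀ h₁ => exact (det_tridiag_add_two a b c s n).trans (by rw [h₀, h₁]; rfl)

/-- Splitting a continuant at position `i`. -/
theorem continuant_split (a d : ℕ → K) (i m : ℕ) :
    rightContinuant a d (i + 2) * leftContinuant a d (i + 1) (m + 1)
      - d i * rightContinuant a d (i + 1) * leftContinuant a d (i + 2) m
      = leftContinuant a d 0 (i + m + 2) := by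
  induction i generalizing m with
  | zero => simp [rightContinuant, leftContinuant]
  | succ i ih =>
    rw [show i + 1 + m + 2 = i + (m + 1) + 2 by ring, ← ih, rightContinuant,
      leftContinuant]
    simp only [Nat.add_sub_cancel]
    ring

theorem rightContinuant_succ_eq (a d : ℕ → K) (m : ℕ) :
    rightContinuant a d (m + 1) = leftContinuant a d 0 (m + 1) := by
  cases m with
  | zero => rfl
  | succ m => simpa [leftContinuant] using continuant_split a d m 0

/-- The entries of the adjugate of a tridiagonal matrix of size `n`. -/
def tridiagAdj (a b c : ℕ → K) (n i j : ℕ) : K :=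
  (-1) ^ (i + j) * (∏ p ∈ Finset.Ico i j, b p) * (∏ p ∈ Finset.Ico j i, c p) *
    rightContinuant a (fun i => b i * c i) (min i j + 1) *
    leftContinuant a (fun i => b i * c i) (max i j + 1) (n - max i j)

theorem tridiagAdj_of_le (a b c : ℕ → K) (n : ℕ) {i j : ℕ} (h : i ≤ j) :
    tridiagAdj a b c n i j = (-1) ^ (i + j) * (∏ p ∈ Finset.Ico i j, b p) *
      rightContinuant a (fun i => b i * c i) (i + 1) *
      leftContinuant a (fun i => b i * c i) (j + 1) (n - j) := by
  simp [tridiagAdj, h]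

theorem tridiagAdj_of_ge (a b c : ℕ → K) (n : ℕ) {i j : ℕ} (h : j ≤ i) :
    tridiagAdj a b c n i j = (-1) ^ (i + j) * (∏ p ∈ Finset.Ico j i, c p) *
      rightContinuant a (fun i => b i * c i) (j + 1) *
      leftContinuant a (fun i => b i * c i) (i + 1) (n - i) := by
  simp [tridiagAdj, h]

theorem tridiagAdj_row (a b c : ℕ → K) {n i j : ℕ} (hi : i < n) (hj : j < n) :
    a i * tridiagAdj a b c n i j + b i * tridiagAdj a b c n (i + 1) j
      + (if i = 0 then 0 else c (i - 1) * tridiagAdj a b c n (i - 1) j)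
      = if i = j then leftContinuant a (fun i => b i * c i) 0 (n + 1) else 0 := by
  rcases lt_trichotomy i j with h | rfl | h
  · rw [if_neg h.ne, tridiagAdj_of_le _ _ _ _ h.le,
      tridiagAdj_of_le _ _ _ _ (show i + 1 ≤ j from h),
      Finset.prod_eq_prod_Ico_succ_bot h, rightContinuant]
    rcases i with _ | i
    · simp [rightContinuant]
      ring
    · rw [if_neg i.succ_ne_zero, Nat.add_sub_cancel, tridiagAdj_of_le _ _ _ _ (by omega),
        Finset.prod_eq_prod_Ico_succ_bot (show i < j by omega),
        Finset.prod_eq_prod_Ico_succ_bot h]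
      ring
  · obtain ⟨m, rfl⟩ := Nat.exists_eq_add_of_lt hi
    rw [if_pos rfl, tridiagAdj_of_le _ _ _ _ le_rfl, tridiagAdj_of_ge _ _ _ _ (show i ≤ i + 1 by omega),
      show i + m + 1 + 1 = i + m + 2 from rfl, ← continuant_split, rightContinuant,
      show i + m + 1 - i = m + 1 by omega, show i + m + 1 - (i + 1) = m by omega]
    have sq : ((-1 : K) ^ i) ^ 2 = 1 := by rw [← pow_mul, mul_comm, pow_mul]; simp
    rcases i with _ | i
    · simp [rightContinuant]
      ring
    · rw [if_neg i.succ_ne_zero, Nat.add_sub_cancel, tridiagAdj_of_le _ _ _ _ (show i ≤ i + 1 by omega),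
        show i + 1 + m + 1 - (i + 1) = m + 1 by omega]
      simp only [Finset.Ico_self, Finset.prod_empty, Nat.Ico_succ_singleton,
        Finset.prod_singleton]
      ring_nf at sq ⊢
      simp only [sq]
      ring
  · obtain ⟨i, rfl⟩ : ∃ l, i = l + 1 := ⟨i - 1, by omega⟩
    obtain ⟨m, rfl⟩ := Nat.exists_eq_add_of_lt hi
    rw [if_neg h.ne', if_neg i.succ_ne_zero, Nat.add_sub_cancel,
      tridiagAdj_of_ge _ _ _ _ h.le, tridiagAdj_of_ge _ _ _ _ (by omega : j ≤ i + 1 + 1),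
      tridiagAdj_of_ge _ _ _ _ (by omega : j ≤ i),
      Finset.prod_Ico_succ_top (by omega : j ≤ i + 1), Finset.prod_Ico_succ_top (by omega : j ≤ i),
      show i + 1 + m + 1 - i = m + 2 by omega, show i + 1 + m + 1 - (i + 1) = m + 1 by omega,
      show i + 1 + m + 1 - (i + 1 + 1) = m by omega,
      leftContinuant]
    ring

theorem tridiag_mul_tridiagAdj (a b c : ℕ → K) (n : ℕ) :
    tridiag a b c 0 n * Matrix.of (fun i j : Fin n => tridiagAdj a b c n i j) =
      (tridiag a b c 0 n).det • 1 := by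
  ext i j
  have hterm (l : ℕ) :
      (if (i : ℕ) = l then a i else if l = (i : ℕ) + 1 then b i
        else if (i : ℕ) = l + 1 then c l else 0) * tridiagAdj a b c n l j =
      (if (i : ℕ) = l then a i * tridiagAdj a b c n l j else 0)
      + (if (i : ℕ) + 1 = l then b i * tridiagAdj a b c n l j else 0)
      + (if (i : ℕ) = l + 1 then c l * tridiagAdj a b c n l j else 0) := by
    split_ifs <;> first | omega | simp
  have hupper : (if (i : ℕ) + 1 < n then b i * tridiagAdj a b c n (i + 1) j else 0)
      = b i * tridiagAdj a b c n (i + 1) j := by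
    split_ifs with h
    · rfl
    · rw [tridiagAdj_of_ge _ _ _ _ (by omega), show n - ((i : ℕ) + 1) = 0 by omega]
      simp [leftContinuant]
  have hlower : ∑ l ∈ Finset.range n,
      (if (i : ℕ) = l + 1 then c l * tridiagAdj a b c n l j else 0) =
      if (i : ℕ) = 0 then 0 else c (i - 1) * tridiagAdj a b c n (i - 1) j := by
    have hi := i.isLt
    generalize (i : ℕ) = i at hi
    rcases i with _ | i
    · simp
    · simp [show i < n by omega]
  rw [Matrix.mul_apply]
  rw [Matrix.smul_apply, det_tridiag]
  simp only [tridiag, Matrix.of_apply, zero_add]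
  rw [Fin.sum_univ_eq_sum_range (fun l => (if (i : ℕ) = l then a i
      else if l = (i : ℕ) + 1 then b i else if (i : ℕ) = l + 1 then c l else 0)
        * tridiagAdj a b c n l j) n]
  simp only [hterm, Finset.sum_add_distrib, Finset.sum_ite_eq, Finset.mem_range, i.isLt,
    if_true, hupper, hlower]
  rw [tridiagAdj_row a b c i.isLt j.isLt]
  simp [Matrix.one_apply, Fin.ext_iff]

theorem triToeplitz_eq_tridiag (k n : ℕ) (a b c : ZMod k → K) :
    triToeplitz k n a b c = tridiag (fun i => a (i + 1 : ℕ)) (fun i => b (i + 1 : ℕ))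
      (fun i => c (i + 1 : ℕ)) 0 n := by
  ext i j
  simp [triToeplitz, tridiag]

theorem univDet_eq_leftContinuant (k n : ℕ) (a d : ZMod k → K) :
    univDet k a d n =
      leftContinuant (fun i => a (i + 1 : ℕ)) (fun i => d (i + 1 : ℕ)) 0 (n + 1) := by
  simp only [univDet, triToeplitz_eq_tridiag, det_tridiag, one_mul]

theorem leftContinuant_add (a d : ℕ → K) (s t m : ℕ) :
    leftContinuant (fun i => a (i + t)) (fun i => d (i + t)) s m =
      leftContinuant a d (s + t) m := by
  induction m using Nat.twoStepInduction generalizing s with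
  | zero => simp [leftContinuant]
  | one => simp [leftContinuant]
  | more m h₀ h₁ =>
    simp only [leftContinuant, h₀, h₁, add_right_comm _ _ t]

theorem univDet_shiftVec (k s n : ℕ) (a d : ZMod k → K) :
    univDet k (shiftVec s a) (shiftVec s d) n =
      leftContinuant (fun i => a (i + 1 : ℕ)) (fun i => d (i + 1 : ℕ)) s (n + 1) := by
  have h := leftContinuant_add (fun i => a (i + 1 : ℕ)) (fun i => d (i + 1 : ℕ)) 0 s (n + 1)
  rw [zero_add] at h
  rw [univDet_eq_leftContinuant, ← h]
  simp only [shiftVec, Nat.cast_add, Nat.cast_one, add_right_comm]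

theorem prod_Icc_succ_eq_prod_Ico (f : ℕ → K) (i j : ℕ) :
    ∏ p ∈ Finset.Icc (i + 1) j, f p = ∏ p ∈ Finset.Ico i j, f (p + 1) := by
  rw [Finset.prod_Ico_add']
  rfl

end Continuants

/-- **Inverse of a tridiagonal `k`-Toeplitz matrix.**
Let `K` be a commutative unital ring, `k, n ≥ 1`, `ā, b̄, c̄ ∈ K^k`, and set
`d_i := b_i·c_i`. If `Δ := D^{ā,d̄}(n,k) = det(T^k_n(ā,b̄,c̄))` is a unit of
`K`, then `T^k_n(ā,b̄,c̄)` is invertible and, for all `1 ≤ i,j ≤ n` (1-based),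
the `(i,j)` entry of its inverse equals
`(−1)^{i+j}·(∏_{p=i}^{j−1} b_p)·(∏_{p=j}^{i−1} c_p)·D^{ā,d̄}(min(i,j)−1,k)·
D_{max(i,j)}^{ā,d̄}(n−max(i,j),k)·Δ⁻¹`, with periodic extensions of `b̄, c̄`
and empty products equal to `1`. -/
theorem triToeplitz_inverse_entries {K : Type*} [CommRing K] {k n : ℕ}
    (hk : 1 ≤ k) (hn : 1 ≤ n) (a b c : ZMod k → K)
    (d : ZMod k → K) (hd : ∀ i, d i = b i * c i)
    (hunit : IsUnit (univDet k a d n)) :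
    IsUnit (triToeplitz k n a b c) ∧
      ∀ i j : Fin n,
        (triToeplitz k n a b c)⁻¹ i j =
          (-1 : K) ^ ((i : ℕ) + 1 + ((j : ℕ) + 1)) *
            (∏ p ∈ Finset.Icc ((i : ℕ) + 1) (j : ℕ), b ((p : ℕ) : ZMod k)) *
            (∏ p ∈ Finset.Icc ((j : ℕ) + 1) (i : ℕ), c ((p : ℕ) : ZMod k)) *
            univDet k a d (min (i : ℕ) (j : ℕ)) *
            univDet k (shiftVec (max (i : ℕ) (j : ℕ) + 1) a)
              (shiftVec (max (i : ℕ) (j : ℕ) + 1) d)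
              (n - (max (i : ℕ) (j : ℕ) + 1)) *
            Ring.inverse (univDet k a d n) := by
  obtain rfl : d = fun i => b i * c i := funext hd
  set A := triToeplitz k n a b c with hA
  set a' : ℕ → K := fun i => a (i + 1 : ℕ)
  set b' : ℕ → K := fun i => b (i + 1 : ℕ)
  set c' : ℕ → K := fun i => c (i + 1 : ℕ)
  have hAtri : A = tridiag a' b' c' 0 n := triToeplitz_eq_tridiag k n a b c
  have hdet : A.det = univDet k a (fun i => b i * c i) n := by
    rw [hAtri, det_tridiag, univDet_eq_leftContinuant]
  rw [← hdet] at hunit ⊢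
  refine ⟨(Matrix.isUnit_iff_isUnit_det A).2 hunit, fun i j => ?_⟩
  have hinv : A⁻¹ = Ring.inverse A.det •
      Matrix.of (fun i j : Fin n => tridiagAdj a' b' c' n i j) := by
    apply Matrix.inv_eq_right_inv
    rw [Matrix.mul_smul, hAtri, tridiag_mul_tridiagAdj, ← hAtri, smul_smul,
      Ring.inverse_mul_cancel _ hunit, one_smul]
  have hmax : n - max (i : ℕ) j = n - (max (i : ℕ) j + 1) + 1 := by
    have := i.isLt
    have := j.isLt
    omega
  rw [hinv, Matrix.smul_apply, Matrix.of_apply, tridiagAdj, univDet_shiftVec,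
    univDet_eq_leftContinuant, rightContinuant_succ_eq, hmax,
    prod_Icc_succ_eq_prod_Ico (fun p => b p), prod_Icc_succ_eq_prod_Ico (fun p => c p),
    smul_eq_mul, show (i : ℕ) + 1 + (j + 1) = i + j + 2 by ring, pow_add _ _ 2, neg_one_sq]
  ring

end
end
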